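/- Let F be a complex Hilbert space, let P and Q be orthogonal projections on F, and let λ be a complex number with λ ≠ 0 and λ ≠ 1. Then λ belongs to the spectrum of P + Q if and only if (λ − 1)² belongs to the spectrum of PQ. -/

import Mathlib

theorem IsIdempotentElem.isUnit_algebraMap_add {K A : Type*} [Field K] [Ring A] [Algebra K A]
    {p : A} (hp : IsIdempotentElem p) {c : K} (h0 : c ≠ 0) (h1 : c + 1 ≠ 0) :
    IsUnit (algebraMap K A c + p) := by
  have hpp : p * p = p := hp
  have hcomm : Commute (algebraMap K A c + p) (algebraMap K A (c + 1) - p) := by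
    have h : ∀ d : K, Commute (algebraMap K A d) p := fun d => Algebra.commutes d p
    have h' : Commute (algebraMap K A c) (algebraMap K A (c + 1)) := Algebra.commutes c _
    exact (h'.sub_right (h c)).add_left ((h (c + 1)).symm.sub_right (Commute.refl p))
  have hmul : (algebraMap K A c + p) * (algebraMap K A (c + 1) - p)
      = algebraMap K A (c * (c + 1)) := by
    simp only [Algebra.algebraMap_eq_smul_one, add_mul, mul_sub, smul_mul_assoc, mul_smul_comm,
      one_mul, mul_one, hpp]
    module
  refine (hcomm.isUnit_mul_iff.mp ?_).1
  rw [hmul]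
  exact (isUnit_iff_ne_zero.mpr (mul_ne_zero h0 h1)).map (algebraMap K A)

theorem IsIdempotentElem.mem_spectrum_add_iff {K A : Type*} [Field K] [Ring A] [Algebra K A]
    {p q : A} (hp : IsIdempotentElem p) (hq : IsIdempotentElem q) {c : K}
    (h0 : c ≠ 0) (h1 : c ≠ 1) :
    c ∈ spectrum K (p + q) ↔ (c - 1) ^ 2 ∈ spectrum K (p * q) := by
  have hpp : p * p = p := hp
  have hqq : q * q = q := hq
  have hc : c - 1 ≠ 0 := sub_ne_zero.mpr h1
  have hc' : c - 1 + 1 ≠ 0 := by simpa using h0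
  obtain ⟨u, hu⟩ := hp.isUnit_algebraMap_add hc hc'
  obtain ⟨v, hv⟩ := hq.isUnit_algebraMap_add hc hc'
  obtain ⟨w, hw⟩ := (isUnit_iff_ne_zero.mpr h0).map (algebraMap K A)
  have key : (u : A) * (algebraMap K A c - (p + q)) * v
      = w * (algebraMap K A ((c - 1) ^ 2) - p * q) := by
    rw [hu, hv, hw]
    simp only [Algebra.algebraMap_eq_smul_one, add_mul, mul_add, sub_mul, mul_sub, smul_mul_assoc,
      mul_smul_comm, one_mul, mul_one, mul_assoc, hpp, hqq]
    module
  rw [spectrum.mem_iff, spectrum.mem_iff, ← Units.isUnit_units_mul u, ← Units.isUnit_mul_units _ v,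
    key, Units.isUnit_units_mul]

theorem stmt_6
    {F : Type*} [NormedAddCommGroup F] [InnerProductSpace ℂ F] [CompleteSpace F]
    (P Q : F →L[ℂ] F)
    (hP1 : IsIdempotentElem P) (hP2 : IsSelfAdjoint P)
    (hQ1 : IsIdempotentElem Q) (hQ2 : IsSelfAdjoint Q)
    (lam : ℂ) (h0 : lam ≠ 0) (h1 : lam ≠ 1) :
    lam ∈ spectrum ℂ (P + Q) ↔ (lam - 1) ^ 2 ∈ spectrum ℂ (P * Q) := by
  exact hP1.mem_spectrum_add_iff hQ1 h0 h1
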